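/- For every complex q with |q| < 1: ∑_{n≥0} q^n/(1 − q^{5n+3}) − ∑_{n≥0} q^{4n+1}/(1 − q^{5n+2}) = (q^5, q^5; q^5)_∞ / (q^2, q^3; q^5)_∞. -/

import Mathlib

/-!
Common definitions: for a partition `π` of `n`,
`numParts` is the number of parts, `largestPart` the largest part,
`omegaOnes` the number of parts equal to 1, `rank` and `crank` the
Dyson rank and Andrews–Garvan crank.  `NT m j n` is the total number of
parts over partitions of `n` with rank ≡ m (mod j), and `Mw m j n` is
the total number of ones over partitions of `n` with crank ≡ m (mod j).
`poch a q = (a; q)_∞ = ∏_{n ≥ 0} (1 - a qⁿ)`.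
-/

namespace Beck

/-- number of parts of a partition -/
def numParts {n : ℕ} (π : n.Partition) : ℕ := Multiset.card π.parts

/-- largest part of a partition (0 for the empty partition) -/
def largestPart {n : ℕ} (π : n.Partition) : ℕ := π.parts.sup

/-- number of ones in a partition -/
def omegaOnes {n : ℕ} (π : n.Partition) : ℕ := π.parts.count 1

/-- number of parts strictly larger than the number of ones -/
def muParts {n : ℕ} (π : n.Partition) : ℕ :=
  Multiset.card (π.parts.filter fun x => omegaOnes π < x)

/-- Dyson's rank: largest part minus number of parts -/
def rank {n : ℕ} (π : n.Partition) : ℤ :=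
  (largestPart π : ℤ) - (numParts π : ℤ)

/-- the Andrews–Garvan crank -/
def crank {n : ℕ} (π : n.Partition) : ℤ :=
  if omegaOnes π = 0 then (largestPart π : ℤ)
  else (muParts π : ℤ) - (omegaOnes π : ℤ)

/-- `NT m j n`: total number of parts in partitions of `n` with rank ≡ m (mod j) -/
def NT (m j n : ℕ) : ℤ :=
  ∑ π : n.Partition,
    if rank π % (j : ℤ) = (m : ℤ) % (j : ℤ) then (numParts π : ℤ) else 0

/-- `Mw m j n`: total number of ones in partitions of `n` with crank ≡ m (mod j) -/
def Mw (m j n : ℕ) : ℤ :=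
  ∑ π : n.Partition,
    if crank π % (j : ℤ) = (m : ℤ) % (j : ℤ) then (omegaOnes π : ℤ) else 0

/-- `(a; q)_∞ = ∏_{n ≥ 0} (1 - a qⁿ)` -/
noncomputable def poch (a q : ℂ) : ℂ := ∏' n : ℕ, (1 - a * q ^ n)

open Finset Filter Topology in
/-- Tannery's theorem for partial sums of a series with bounded, pointwise convergent weights. -/
theorem tendsto_sum_range_mul_of_bounded {u : ℕ → ℂ} (hu : Summable fun m => ‖u m‖)
    {F : ℕ → ℕ → ℂ} {C : ℝ} (hC : ∀ N m, ‖F N m‖ ≤ C) {L : ℂ}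
    (hF : ∀ m, Tendsto (fun N => F N m) atTop (𝓝 L)) {s : ℕ → ℕ} (hs : Tendsto s atTop atTop) :
    Tendsto (fun N => ∑ m ∈ range (s N), u m * F N m) atTop (𝓝 ((∑' m, u m) * L)) := by
  have hC0 : 0 ≤ C := (norm_nonneg _).trans (hC 0 0)
  rw [← tsum_mul_right]
  have key := tendsto_tsum_of_dominated_convergence (𝓕 := atTop)
    (f := fun N m => if m ∈ range (s N) then u m * F N m else 0) (g := fun m => u m * L)
    (bound := fun m => ‖u m‖ * C) (hu.mul_right C) ?_ ?_
  · refine key.congr fun N => ?_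
    rw [tsum_eq_sum (s := range (s N)) fun m hm => if_neg hm]
    exact sum_congr rfl fun m hm => if_pos hm
  · intro m
    refine ((hF m).const_mul (u m)).congr' ?_
    filter_upwards [hs.eventually_gt_atTop m] with N hN
    rw [if_pos (mem_range.2 hN)]
  · refine Eventually.of_forall fun N m => ?_
    split_ifs
    · rw [norm_mul]
      exact mul_le_mul_of_nonneg_left (hC N m) (norm_nonneg _)
    · rw [norm_zero]
      positivity

/-- `(a; p)_n = ∏_{0 ≤ j < n} (1 - a pʲ)` -/
noncomputable def finPoch (a p : ℂ) (n : ℕ) : ℂ := ∏ j ∈ Finset.range n, (1 - a * p ^ j)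

theorem one_sub_ne_zero_of_norm_lt_one {c : ℂ} (hc : ‖c‖ < 1) : 1 - c ≠ 0 := by
  intro h
  rw [← sub_eq_zero.1 h, norm_one] at hc
  exact lt_irrefl _ hc

theorem norm_mul_pow_lt_one {a p : ℂ} (ha : ‖a‖ < 1) (hp : ‖p‖ < 1) (n : ℕ) :
    ‖a * p ^ n‖ < 1 := by
  rw [norm_mul, norm_pow]
  exact (mul_le_of_le_one_right (norm_nonneg _) (pow_le_one₀ (norm_nonneg _) hp.le)).trans_lt ha

theorem finPoch_ne_zero {a p : ℂ} (ha : ‖a‖ < 1) (hp : ‖p‖ < 1) (n : ℕ) : finPoch a p n ≠ 0 :=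
  Finset.prod_ne_zero_iff.2 fun j _ =>
    one_sub_ne_zero_of_norm_lt_one (norm_mul_pow_lt_one ha hp j)

theorem summable_norm_neg_mul_pow (a : ℂ) {p : ℂ} (hp : ‖p‖ < 1) :
    Summable fun n : ℕ => ‖-(a * p ^ n)‖ := by
  simpa only [norm_neg, norm_mul] using! (summable_norm_geometric_of_norm_lt_one hp).mul_left ‖a‖

open Filter Topology in
theorem tendsto_finPoch (a : ℂ) {p : ℂ} (hp : ‖p‖ < 1) :
    Tendsto (finPoch a p) atTop (𝓝 (poch a p)) := by
  have h := (multipliable_one_add_of_summable (summable_norm_neg_mul_pow a hp)).hasProd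
  simpa only [← sub_eq_add_neg] using! h.tendsto_prod_nat

theorem poch_ne_zero {a p : ℂ} (ha : ‖a‖ < 1) (hp : ‖p‖ < 1) : poch a p ≠ 0 := by
  have h := tprod_one_add_ne_zero_of_summable (f := fun n : ℕ => -(a * p ^ n)) (fun n => by
    rw [← sub_eq_add_neg]
    exact one_sub_ne_zero_of_norm_lt_one (norm_mul_pow_lt_one ha hp n))
    (summable_norm_neg_mul_pow a hp)
  simpa only [← sub_eq_add_neg] using! h

theorem pow_injective_of_norm_lt_one {p : ℂ} (hp0 : p ≠ 0) (hp : ‖p‖ < 1) :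
    Function.Injective fun n : ℕ => p ^ n := fun m n h =>
  (pow_right_strictAnti₀ (norm_pos_iff.2 hp0) hp).injective <| by
    simpa only [norm_pow] using congrArg norm h

open Finset in
theorem prod_range_pow_mul_sub {p z : ℂ} (hz : z ≠ 0) (y : ℂ) (n : ℕ) :
    ∏ j ∈ range n, (p ^ n * y - z * p ^ j)
      = (-z) ^ n * (∏ j ∈ range n, p ^ j) * finPoch (p * y / z) p n := by
  have hconst : (-z) ^ n = ∏ _j ∈ range n, -z := by rw [prod_const, card_range]
  rw [finPoch, ← prod_range_reflect (fun j => 1 - p * y / z * p ^ j), hconst,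
    ← prod_mul_distrib, ← prod_mul_distrib]
  refine prod_congr rfl fun j hj => ?_
  obtain ⟨i, rfl⟩ := Nat.exists_eq_add_of_lt (mem_range.1 hj)
  rw [show j + i + 1 - 1 - j = i by omega]
  field_simp
  ring

open Finset in
theorem prod_range_pow_mul_sub_add (p : ℂ) {y : ℂ} (hy : y ≠ 0) (z : ℂ) (n k : ℕ) :
    ∏ i ∈ range k, (p ^ n * y - z * p ^ (n + i)) = (p ^ n * y) ^ k * finPoch (z / y) p k := by
  rw [finPoch, ← card_range k, ← prod_const, card_range, ← prod_mul_distrib]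
  refine prod_congr rfl fun j _ => ?_
  field_simp
  ring

open Finset Polynomial in
/-- Partial fractions with simple poles at `pⁿ`, `n ≤ K`. -/
theorem sum_partial_fractions {p : ℂ} (hp0 : p ≠ 0) (hp : ‖p‖ < 1) {z : ℂ} (hz : z ≠ 0) (K : ℕ)
    {x : ℂ} (hx : ∀ n, x - p ^ n ≠ 0) :
    ∑ n ∈ range (K + 1), z ^ n * (finPoch (p / z) p n / finPoch p p n)
        * (finPoch z p (K - n) / finPoch p p (K - n)) / (x - p ^ n)
      = (∏ j ∈ range K, (x - z * p ^ j)) / ∏ j ∈ range (K + 1), (x - p ^ j) := by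
  have hinj := pow_injective_of_norm_lt_one hp0 hp
  set f : ℂ[X] := ∏ j ∈ range K, (X - C (z * p ^ j)) with hf
  have heval (t : ℂ) : f.eval t = ∏ j ∈ range K, (t - z * p ^ j) := by
    simp [hf, eval_prod]
  have hdeg : f.degree < #(range (K + 1)) := by
    rw [hf, degree_prod]
    simp only [degree_X_sub_C, sum_const, card_range, nsmul_eq_mul, mul_one]
    exact_mod_cast K.lt_succ_self
  have h := Lagrange.eq_interpolate (s := range (K + 1)) (v := fun n => p ^ n) hinj.injOn hdeg
  have h' := congrArg (eval x) h
  rw [Lagrange.eval_interpolate_not_at_node _ fun n _ => sub_ne_zero.1 (hx n), heval,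
    Lagrange.eval_nodal] at h'
  rw [h', mul_div_cancel_left₀ _ (prod_ne_zero_iff.2 fun n _ => hx n)]
  refine sum_congr rfl fun n hn => ?_
  obtain ⟨k, rfl⟩ := Nat.exists_eq_add_of_le (Nat.lt_succ_iff.1 (mem_range.1 hn))
  have hnum : ∏ j ∈ range (n + k), (p ^ n - z * p ^ j)
      = (-z) ^ n * (∏ j ∈ range n, p ^ j) * finPoch (p / z) p n
        * ((p ^ n) ^ k * finPoch z p k) := by
    have h1 := prod_range_pow_mul_sub (p := p) hz 1 n
    have h2 := prod_range_pow_mul_sub_add p one_ne_zero z n k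
    simp only [mul_one, div_one] at h1 h2
    rw [prod_range_add, h1, h2]
  have hden : ∏ j ∈ (range (n + k + 1)).erase n, (p ^ n - p ^ j)
      = (-1) ^ n * (∏ j ∈ range n, p ^ j) * finPoch p p n * ((p ^ n) ^ k * finPoch p p k) := by
    have h1 := prod_range_pow_mul_sub (p := p) one_ne_zero 1 n
    have h2 := prod_range_pow_mul_sub_add p one_ne_zero p n k
    simp only [mul_one, div_one, one_mul] at h1 h2
    have hset : (range (n + k + 1)).erase n
        = (range n).disjUnion ((range k).map (addLeftEmbedding (n + 1))) (by
          rw [disjoint_left]; intro i; simp; omega) := by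
      ext i
      simp only [mem_erase, mem_range, mem_disjUnion, mem_map, addLeftEmbedding_apply]
      constructor
      · rintro ⟨h1, h2⟩
        by_cases h3 : i < n
        · exact Or.inl h3
        · exact Or.inr ⟨i - (n + 1), by omega, by omega⟩
      · rintro (h | ⟨j, h, rfl⟩) <;> omega
    rw [hset, prod_disjUnion, h1, prod_map, ← h2]
    congr 1
    refine prod_congr rfl fun i _ => ?_
    rw [addLeftEmbedding_apply]
    ring
  have hP : ∏ j ∈ range n, p ^ j ≠ 0 := prod_ne_zero_iff.2 fun j _ => pow_ne_zero _ hp0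
  have hn0 := finPoch_ne_zero hp hp n
  have hk0 := finPoch_ne_zero hp hp k
  have hxn := hx n
  rw [Lagrange.nodalWeight, prod_inv_distrib, hden, heval, hnum, Nat.add_sub_cancel_left,
    neg_pow z]
  have hneg : (-1 : ℂ) ^ n ≠ 0 := pow_ne_zero _ (by norm_num)
  field_simp

open Finset in
/-- A finite form of the bilateral summation `tsum_sub_tsum_eq_poch`. -/
theorem sum_add_sum_eq_finPoch {p : ℂ} (hp0 : p ≠ 0) (hp : ‖p‖ < 1) {a z : ℂ}
    (ha0 : a ≠ 0) (ha : ‖a‖ < 1) (hb : ‖p / a‖ < 1) (hz : z ≠ 0) (N : ℕ) :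
    ∑ m ∈ range (N + 1), z ^ m / (1 - a * p ^ m)
        * ((finPoch (p / z) p (N + m) / finPoch p p (N + m))
          * (finPoch z p (N - m) / finPoch p p (N - m)))
      + ∑ k ∈ range N, -(p / z / a) * ((p / z) ^ k / (1 - p / a * p ^ k))
        * ((finPoch (p / z) p (N - 1 - k) / finPoch p p (N - 1 - k))
          * (finPoch z p (N + 1 + k) / finPoch p p (N + 1 + k)))
      = finPoch (a * z) p N * finPoch (p / (a * z)) p N
        / (finPoch (p / a) p N * finPoch a p (N + 1)) := by
  have hA (n : ℕ) : 1 - a * p ^ n ≠ 0 :=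
    one_sub_ne_zero_of_norm_lt_one (norm_mul_pow_lt_one ha hp n)
  have hB (n : ℕ) : 1 - p / a * p ^ n ≠ 0 :=
    one_sub_ne_zero_of_norm_lt_one (norm_mul_pow_lt_one hb hp n)
  have hright (m : ℕ) : p ^ N * a⁻¹ - p ^ (N + m) = p ^ N * a⁻¹ * (1 - a * p ^ m) := by
    field_simp
    ring
  have hleft (j k : ℕ) (h : N = j + k + 1) :
      p ^ N * a⁻¹ - p ^ j = -p ^ j * (1 - p / a * p ^ k) := by
    rw [h]
    field_simp
    ring
  have hx (n : ℕ) : p ^ N * a⁻¹ - p ^ n ≠ 0 := by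
    rcases le_or_gt N n with h | h
    · obtain ⟨m, rfl⟩ := Nat.exists_eq_add_of_le h
      rw [hright]
      exact mul_ne_zero (mul_ne_zero (pow_ne_zero _ hp0) (inv_ne_zero ha0)) (hA m)
    · obtain ⟨k, hk⟩ := Nat.exists_eq_add_of_lt h
      rw [hleft n k hk]
      exact mul_ne_zero (neg_ne_zero.2 (pow_ne_zero _ hp0)) (hB k)
  have hmain := sum_partial_fractions hp0 hp hz (N + N) hx
  have hP : ∏ j ∈ range N, p ^ j ≠ 0 := prod_ne_zero_iff.2 fun j _ => pow_ne_zero _ hp0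
  have hrhs : (∏ j ∈ range (N + N), (p ^ N * a⁻¹ - z * p ^ j))
      / ∏ j ∈ range (N + N + 1), (p ^ N * a⁻¹ - p ^ j)
      = z ^ N * a / p ^ N * (finPoch (a * z) p N * finPoch (p / (a * z)) p N
        / (finPoch (p / a) p N * finPoch a p (N + 1))) := by
    have h1 := prod_range_pow_mul_sub (p := p) one_ne_zero a⁻¹ N
    have h2 := prod_range_pow_mul_sub_add p (inv_ne_zero ha0) 1 N (N + 1)
    simp only [one_mul] at h1 h2
    have e1 : p * a⁻¹ / z = p / (a * z) := by field_simp
    have e2 : z / a⁻¹ = a * z := by field_simp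
    have e3 : p * a⁻¹ / 1 = p / a := by field_simp
    have e4 : 1 / a⁻¹ = a := by field_simp
    rw [add_assoc N N 1, prod_range_add, prod_range_add, prod_range_pow_mul_sub hz,
      prod_range_pow_mul_sub_add p (inv_ne_zero ha0), h1, h2, e1, e2, e3, e4]
    have hneg : (-1 : ℂ) ^ N ≠ 0 := pow_ne_zero _ (by norm_num)
    have := finPoch_ne_zero hb hp N
    have := finPoch_ne_zero ha hp (N + 1)
    rw [neg_pow z, pow_succ]
    field_simp
  have hc : z ^ N * a / p ^ N ≠ 0 :=
    div_ne_zero (mul_ne_zero (pow_ne_zero _ hz) ha0) (pow_ne_zero _ hp0)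
  rw [hrhs, add_assoc N N 1, sum_range_add, ← sum_range_reflect, add_comm] at hmain
  refine mul_left_cancel₀ hc (Eq.trans ?_ hmain)
  rw [mul_add, mul_sum, mul_sum]
  congr 1
  · refine sum_congr rfl fun m hm => ?_
    have := hA m
    rw [hright, show N + N - (N + m) = N - m by omega, pow_add]
    field_simp
  · refine sum_congr rfl fun k hk => ?_
    obtain ⟨j, hj⟩ := Nat.exists_eq_add_of_lt (mem_range.1 hk)
    have := hB k
    rw [show N + N - (N - 1 - k) = N + 1 + k by omega, show N - 1 - k = j by omega,
      hleft j k (by omega)]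
    have e : z ^ N * a / p ^ N * (-(p / z / a) * ((p / z) ^ k / (1 - p / a * p ^ k)))
        = z ^ j / (-p ^ j * (1 - p / a * p ^ k)) := by
      rw [show N = j + k + 1 by omega, div_pow]
      generalize 1 - p / a * p ^ k = t at this
      field_simp
      ring
    rw [← mul_assoc, e]
    ring

theorem summable_norm_pow_div_one_sub {a p z : ℂ} (hp : ‖p‖ < 1) (ha : ‖a‖ < 1) (hz : ‖z‖ < 1) :
    Summable fun m : ℕ => ‖z ^ m / (1 - a * p ^ m)‖ := by
  refine .of_nonneg_of_le (fun _ => norm_nonneg _) (fun m => ?_)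
    ((summable_norm_geometric_of_norm_lt_one hz).mul_right (1 - ‖a‖)⁻¹)
  rw [norm_div, div_eq_mul_inv]
  have h1 : 1 - ‖a * p ^ m‖ ≤ ‖1 - a * p ^ m‖ := by
    simpa using norm_sub_norm_le 1 (a * p ^ m)
  have h2 : ‖a * p ^ m‖ ≤ ‖a‖ := by
    rw [norm_mul, norm_pow]
    exact mul_le_of_le_one_right (norm_nonneg _) (pow_le_one₀ (norm_nonneg _) hp.le)
  have h3 : 0 < 1 - ‖a‖ := sub_pos.2 ha
  gcongr
  linarith

open Filter Topology in
theorem tendsto_finPoch_div_finPoch (a : ℂ) {p : ℂ} (hp : ‖p‖ < 1) :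
    Tendsto (fun n => finPoch a p n / finPoch p p n) atTop (𝓝 (poch a p / poch p p)) :=
  (tendsto_finPoch a hp).div (tendsto_finPoch p hp) (poch_ne_zero hp hp)

open Filter Topology in
theorem exists_norm_le_of_tendsto {f : ℕ → ℂ} {l : ℂ} (h : Tendsto f atTop (𝓝 l)) :
    ∃ C, ∀ n, ‖f n‖ ≤ C := by
  obtain ⟨C, hC⟩ := (Metric.isBounded_range_of_tendsto f h).exists_norm_le
  exact ⟨C, fun n => hC _ ⟨n, rfl⟩⟩

open Filter Topology in
/-- The case `b = a p` of Ramanujan's `₁ψ₁` summation. -/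
theorem tsum_sub_tsum_eq_poch {p : ℂ} (hp0 : p ≠ 0) (hp : ‖p‖ < 1) {a z : ℂ}
    (ha0 : a ≠ 0) (ha : ‖a‖ < 1) (hb : ‖p / a‖ < 1)
    (hz0 : z ≠ 0) (hz : ‖z‖ < 1) (hw : ‖p / z‖ < 1) :
    (∑' m : ℕ, z ^ m / (1 - a * p ^ m))
        - p / z / a * ∑' k : ℕ, (p / z) ^ k / (1 - p / a * p ^ k)
      = poch p p ^ 2 * (poch (a * z) p * poch (p / (a * z)) p)
        / (poch a p * poch (p / a) p * (poch z p * poch (p / z) p)) := by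
  have hA := tendsto_finPoch_div_finPoch (p / z) hp
  have hB := tendsto_finPoch_div_finPoch z hp
  obtain ⟨C, hC⟩ := exists_norm_le_of_tendsto hA
  obtain ⟨D, hD⟩ := exists_norm_le_of_tendsto hB
  have hbound (i j : ℕ) : ‖(finPoch (p / z) p i / finPoch p p i)
      * (finPoch z p j / finPoch p p j)‖ ≤ C * D := by
    rw [norm_mul]
    exact mul_le_mul (hC i) (hD j) (norm_nonneg _) ((norm_nonneg _).trans (hC i))
  have hsub (m : ℕ) : Tendsto (fun N => N - m) atTop atTop := tendsto_sub_atTop_nat m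
  have hadd (m : ℕ) : Tendsto (fun N => N + m) atTop atTop := tendsto_add_atTop_nat m
  have hright := tendsto_sum_range_mul_of_bounded (summable_norm_pow_div_one_sub hp ha hz)
    (fun N m => hbound (N + m) (N - m))
    (fun m => (hA.comp (hadd m)).mul (hB.comp (hsub m))) (hadd 1)
  have hu : Summable fun k : ℕ => ‖-(p / z / a) * ((p / z) ^ k / (1 - p / a * p ^ k))‖ := by
    simpa only [norm_mul] using
      (summable_norm_pow_div_one_sub hp hb hw).mul_left ‖-(p / z / a)‖
  have hleft := tendsto_sum_range_mul_of_bounded hu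
    (fun N k => hbound (N - 1 - k) (N + 1 + k))
    (fun k => (hA.comp ((hsub k).comp (hsub 1))).mul (hB.comp ((hadd k).comp (hadd 1)))) tendsto_id
  have hlim := ((tendsto_finPoch (a * z) hp).mul (tendsto_finPoch (p / (a * z)) hp)).div
    ((tendsto_finPoch (p / a) hp).mul ((tendsto_finPoch a hp).comp (hadd 1)))
    (mul_ne_zero (poch_ne_zero hb hp) (poch_ne_zero ha hp))
  have h := tendsto_nhds_unique ((hright.add hleft).congr fun N =>
    sum_add_sum_eq_finPoch hp0 hp ha0 ha hb hz0 N) hlim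
  rw [tsum_mul_left, ← add_mul, neg_mul, ← sub_eq_add_neg] at h
  have := poch_ne_zero hp hp
  have := poch_ne_zero ha hp
  have := poch_ne_zero hb hp
  have := poch_ne_zero hz hp
  have := poch_ne_zero hw hp
  generalize (∑' m : ℕ, z ^ m / (1 - a * p ^ m))
        - p / z / a * ∑' k : ℕ, (p / z) ^ k / (1 - p / a * p ^ k) = S at h ⊢
  generalize poch (a * z) p * poch (p / (a * z)) p = R at h ⊢
  rw [eq_div_iff (by positivity)] at h ⊢
  field_simp at h
  linear_combination h

/-- Identity (2.7):
`∑_{n≥0} qⁿ/(1 − q^{5n+3}) − ∑_{n≥0} q^{4n+1}/(1 − q^{5n+2})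
  = (q⁵, q⁵; q⁵)_∞ / (q², q³; q⁵)_∞` for `|q| < 1`. -/
theorem statement_10 (q : ℂ) (hq : ‖q‖ < 1) :
    (∑' n : ℕ, q ^ n / (1 - q ^ (5 * n + 3)))
      - ∑' n : ℕ, q ^ (4 * n + 1) / (1 - q ^ (5 * n + 2))
    = (poch (q ^ 5) (q ^ 5) * poch (q ^ 5) (q ^ 5))
      / (poch (q ^ 2) (q ^ 5) * poch (q ^ 3) (q ^ 5)) := by
  rcases eq_or_ne q 0 with rfl | hq0
  · have h : (∑' n : ℕ, (0 : ℂ) ^ n / (1 - 0 ^ (5 * n + 3))) = 1 := by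
      rw [tsum_eq_single 0 fun n hn => by simp [hn]]
      simp
    rw [h]
    simp [poch]
  have hpow (n : ℕ) (hn : n ≠ 0) : ‖q ^ n‖ < 1 := by
    rw [norm_pow]
    exact pow_lt_one₀ (norm_nonneg _) hq hn
  have e1 : q ^ 5 / q = q ^ 4 := by field_simp
  have e2 : q ^ 5 / q ^ 3 = q ^ 2 := by field_simp
  have e3 : q ^ 3 * q = q ^ 4 := by ring
  have e4 : q ^ 5 / q ^ 4 = q := by field_simp
  have e5 : q ^ 4 / q ^ 3 = q := by field_simp
  have h := tsum_sub_tsum_eq_poch (p := q ^ 5) (a := q ^ 3) (z := q) (pow_ne_zero _ hq0)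
    (hpow 5 (by norm_num)) (pow_ne_zero _ hq0) (hpow 3 (by norm_num))
    (e2 ▸ hpow 2 (by norm_num)) hq0 hq (e1 ▸ hpow 4 (by norm_num))
  rw [e1, e2, e3, e4, e5, ← tsum_mul_left] at h
  have h1 := poch_ne_zero hq (hpow 5 (by norm_num))
  have h4 := poch_ne_zero (hpow 4 (by norm_num)) (hpow 5 (by norm_num))
  have h2 := poch_ne_zero (hpow 2 (by norm_num)) (hpow 5 (by norm_num))
  have h3 := poch_ne_zero (hpow 3 (by norm_num)) (hpow 5 (by norm_num))
  convert h using 1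
  · congr 1
    · refine tsum_congr fun n => ?_
      rw [← pow_mul, ← pow_add, add_comm 3]
    · refine tsum_congr fun n => ?_
      rw [← pow_mul, ← pow_mul, ← pow_add, add_comm 2, ← mul_div_assoc, ← pow_succ']
  · field_simp

end Beck
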